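/- arXiv:math/0601149 — 2 statements merged into one kernel-verified Lean document; each statement's English description precedes it below -/
import Mathlib

section
/- Let E be a real normed vector space, let n be a positive natural number, let f : ℝ → ℝ be infinitely differentiable, let y : E → ℝ be infinitely differentiable, and let v₁, …, vₙ be arbitrary (not necessarily distinct) vectors of E. Then for every point x ∈ E, the iterated directional derivative of f ∘ y along v₁, …, vₙ (taking one directional derivative along each vᵢ) evaluated at x equals the sum, over all partitions π of the index set {1, …, n}, of f^(|π|)(y(x)) times the product over the blocks B of π of the iterated directional derivative of y along the vectors (v_j)_{j ∈ B} evaluated at x. In particular, the formula for mixed partial derivatives of a composition is unchanged when some of the differentiation variables are identified with one another: identifying variables merely makes some terms of the sum coincide. -/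
/-- Iterated directional (line) derivative along a list of direction vectors. -/
noncomputable def iterLineDeriv {E : Type*} [NormedAddCommGroup E] [NormedSpace ℝ E] :
    List E → (E → ℝ) → E → ℝ
  | [], g => g
  | v :: vs, g => fun x => lineDeriv ℝ (iterLineDeriv vs g) x v

open scoped ContDiff

section LineDeriv

variable {E : Type*} [NormedAddCommGroup E] [NormedSpace ℝ E]

theorem ContDiff.lineDeriv_infty {g : E → ℝ} (hg : ContDiff ℝ ∞ g) (v : E) :
    ContDiff ℝ ∞ (fun x => lineDeriv ℝ g x v) := by
  have h : (fun x => lineDeriv ℝ g x v) = fun x => fderiv ℝ g x v :=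
    funext fun x => (hg.differentiable (by simp) x).lineDeriv_eq_fderiv
  rw [h]
  exact (hg.fderiv_right (by simp)).clm_apply contDiff_const

theorem ContDiff.lineDeriv_comm {g : E → ℝ} (hg : ContDiff ℝ ∞ g) (v w x : E) :
    lineDeriv ℝ (fun z => lineDeriv ℝ g z v) x w =
      lineDeriv ℝ (fun z => lineDeriv ℝ g z w) x v := by
  have key (v w : E) : lineDeriv ℝ (fun z => lineDeriv ℝ g z v) x w =
      fderiv ℝ (fderiv ℝ g) x w v := by
    have h : (fun x => lineDeriv ℝ g x v) = fun x => fderiv ℝ g x v :=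
      funext fun x => (hg.differentiable (by simp) x).lineDeriv_eq_fderiv
    have hd : DifferentiableAt ℝ (fderiv ℝ g) x :=
      (hg.fderiv_right (m := ∞) (by simp)).differentiable (by simp) x
    rw [((hg.lineDeriv_infty v).differentiable (by simp) x).lineDeriv_eq_fderiv, h,
      fderiv_clm_apply hd (differentiableAt_const v)]
    simp
  rw [key, key]
  exact hg.contDiffAt.isSymmSndFDerivAt (by simpa using WithTop.coe_le_coe.2 (le_top (a := (2 : ℕ∞)))) w v

theorem ContDiff.iterLineDeriv {g : E → ℝ} (hg : ContDiff ℝ ∞ g) (l : List E) :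
    ContDiff ℝ ∞ (iterLineDeriv l g) := by
  induction l with
  | nil => exact hg
  | cons v l ih => exact ih.lineDeriv_infty v

theorem iterLineDeriv_perm {g : E → ℝ} (hg : ContDiff ℝ ∞ g) {l l' : List E} (h : l.Perm l') :
    iterLineDeriv l g = iterLineDeriv l' g := by
  induction h with
  | nil => rfl
  | cons v _ ih => simp only [iterLineDeriv, ih]
  | swap v w l =>
    funext x
    exact (hg.iterLineDeriv l).lineDeriv_comm v w x
  | trans _ _ ih₁ ih₂ => exact ih₁.trans ih₂

theorem iterLineDeriv_toList_insert {ι : Type*} [DecidableEq ι] {g : E → ℝ}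
    (hg : ContDiff ℝ ∞ g) (v : ι → E) {s : Finset ι} {a : ι} (ha : a ∉ s) (x : E) :
    iterLineDeriv ((insert a s).toList.map v) g x =
      lineDeriv ℝ (iterLineDeriv (s.toList.map v) g) x (v a) := by
  rw [iterLineDeriv_perm hg ((Finset.toList_insert ha).map v)]
  rfl

end LineDeriv

namespace Finpartition

variable {ι : Type*} [DecidableEq ι]

/-- Adjoin a new element `a` to the block `B` of a partition of `s`, or as the singleton block
`{a}` when `B` is empty. -/
def adjoin {s : Finset ι} {a : ι} (ha : a ∉ s) (π : Finpartition s) (B : Finset ι)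
    (hB : B ∈ insert ∅ π.parts) : Finpartition (insert a s) :=
  ofExistsUnique (insert (insert a B) (π.parts.erase B))
    (by
      intro p hp
      have hBs : B ⊆ s := by
        rcases Finset.mem_insert.1 hB with rfl | h
        · simp
        · exact π.le h
      rcases Finset.mem_insert.1 hp with rfl | h
      · exact Finset.insert_subset_insert a hBs
      · exact (π.le (Finset.mem_of_mem_erase h)).trans (Finset.subset_insert a s))
    (by
      intro b hb
      rcases Finset.mem_insert.1 hb with rfl | hbs
      · refine ⟨insert b B, by simp, ?_⟩
        rintro p ⟨hp, hbp⟩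
        rcases Finset.mem_insert.1 hp with rfl | h
        · rfl
        · exact absurd (π.le (Finset.mem_of_mem_erase h) hbp) ha
      · have hba : b ≠ a := fun h => ha (h ▸ hbs)
        obtain ⟨t, ht, hbt⟩ := π.exists_mem hbs
        by_cases hbB : b ∈ B
        · refine ⟨insert a B, by simp [hbB], ?_⟩
          rintro p ⟨hp, hbp⟩
          rcases Finset.mem_insert.1 hp with rfl | h
          · rfl
          · have hB' : B ∈ π.parts := by
              rcases Finset.mem_insert.1 hB with rfl | h
              · simp at hbB
              · exact h
            exact absurd (π.eq_of_mem_parts (Finset.mem_of_mem_erase h) hB' hbp hbB)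
              (Finset.ne_of_mem_erase h)
        · refine ⟨t, ⟨Finset.mem_insert_of_mem
            (Finset.mem_erase.2 ⟨fun h => hbB (h ▸ hbt), ht⟩), hbt⟩, ?_⟩
          rintro p ⟨hp, hbp⟩
          rcases Finset.mem_insert.1 hp with rfl | h
          · simp [hba, hbB] at hbp
          · exact π.eq_of_mem_parts (Finset.mem_of_mem_erase h) ht hbp hbt)
    (by
      intro h
      rcases Finset.mem_insert.1 h with h | h
      · exact Finset.insert_ne_empty a B h.symm
      · exact π.empty_notMem_parts (Finset.mem_of_mem_erase h))

theorem parts_adjoin {s : Finset ι} {a : ι} (ha : a ∉ s) (π : Finpartition s) (B : Finset ι)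
    (hB : B ∈ insert ∅ π.parts) :
    (π.adjoin ha B hB).parts = insert (insert a B) (π.parts.erase B) := rfl

theorem notMem_of_mem_insert_empty_parts {s : Finset ι} {a : ι} (ha : a ∉ s)
    (π : Finpartition s) {B : Finset ι} (hB : B ∈ insert ∅ π.parts) : a ∉ B := by
  rcases Finset.mem_insert.1 hB with rfl | h
  · simp
  · exact fun haB => ha (π.le h haB)

theorem adjoin_inj {s : Finset ι} {a : ι} (ha : a ∉ s) {π π' : Finpartition s}
    {B B' : Finset ι} {hB : B ∈ insert ∅ π.parts} {hB' : B' ∈ insert ∅ π'.parts}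
    (h : π.adjoin ha B hB = π'.adjoin ha B' hB') : π = π' ∧ B = B' := by
  have hparts := congrArg Finpartition.parts h
  rw [parts_adjoin, parts_adjoin] at hparts
  have haB := notMem_of_mem_insert_empty_parts ha π hB
  have haB' := notMem_of_mem_insert_empty_parts ha π' hB'
  have hna {π : Finpartition s} {t : Finset ι} (ht : t ∈ π.parts) : a ∉ t :=
    notMem_of_mem_insert_empty_parts ha π (Finset.mem_insert_of_mem ht)
  have hBB : B = B' := by
    have hmem : insert a B ∈ insert (insert a B') (π'.parts.erase B') := by
      rw [← hparts]; exact Finset.mem_insert_self _ _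
    rcases Finset.mem_insert.1 hmem with h | h
    · rw [← Finset.erase_insert haB, h, Finset.erase_insert haB']
    · exact absurd (Finset.mem_insert_self a B) (hna (Finset.mem_of_mem_erase h))
  subst hBB
  refine ⟨?_, rfl⟩
  have hnot (π : Finpartition s) : insert a B ∉ π.parts.erase B := fun h =>
    hna (Finset.mem_of_mem_erase h) (Finset.mem_insert_self a B)
  have herase : π.parts.erase B = π'.parts.erase B := by
    rw [← Finset.erase_insert (hnot π), hparts, Finset.erase_insert (hnot π')]
  refine Finpartition.ext ?_
  rcases Finset.mem_insert.1 hB with rfl | h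
  · rwa [Finset.erase_eq_of_notMem π.empty_notMem_parts,
      Finset.erase_eq_of_notMem π'.empty_notMem_parts] at herase
  · have hne : B ≠ ∅ := π.ne_empty h
    have h' : B ∈ π'.parts := (Finset.mem_insert.1 hB').resolve_left hne
    rw [← Finset.insert_erase h, herase, Finset.insert_erase h']

theorem exists_adjoin_eq {s : Finset ι} {a : ι} (ha : a ∉ s) (ρ : Finpartition (insert a s)) :
    ∃ (π : Finpartition s) (B : Finset ι) (hB : B ∈ insert ∅ π.parts),
      π.adjoin ha B hB = ρ := by
  have hpart : ρ.part a ∈ ρ.parts := ρ.part_mem.2 (Finset.mem_insert_self a s)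
  have hapart : a ∈ ρ.part a := ρ.mem_part_self.2 (Finset.mem_insert_self a s)
  have hs : insert a s \ {a} = s := by
    rw [Finset.insert_sdiff_of_mem _ (Finset.mem_singleton_self a),
      Finset.sdiff_singleton_eq_erase, Finset.erase_eq_of_notMem ha]
  have hmem (c : Finset ι) : c ∈ ((ρ.avoid {a}).copy hs).parts ↔
      c ≠ ∅ ∧ ((c ∈ ρ.parts ∧ a ∉ c) ∨ c = (ρ.part a).erase a) := by
    change c ∈ (ρ.avoid {a}).parts ↔ _
    rw [mem_avoid]
    constructor
    · rintro ⟨d, hd, hda, rfl⟩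
      refine ⟨fun h => hda (Finset.sdiff_eq_empty_iff_subset.1 h), ?_⟩
      by_cases had : a ∈ d
      · right
        rw [ρ.part_eq_of_mem hd had, Finset.sdiff_singleton_eq_erase]
      · left
        rw [Finset.sdiff_singleton_eq_erase, Finset.erase_eq_of_notMem had]
        exact ⟨hd, had⟩
    · rintro ⟨hc, ⟨hcρ, hac⟩ | rfl⟩
      · refine ⟨c, hcρ, fun h => ?_, by
          rw [Finset.sdiff_singleton_eq_erase, Finset.erase_eq_of_notMem hac]⟩
        rcases Finset.subset_singleton_iff.1 h with h | h
        · exact hc h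
        · simp [h] at hac
      · refine ⟨ρ.part a, hpart, fun h => hc ?_, Finset.sdiff_singleton_eq_erase _ _⟩
        rw [← Finset.sdiff_singleton_eq_erase]
        exact Finset.sdiff_eq_empty_iff_subset.2 h
  refine ⟨(ρ.avoid {a}).copy hs, (ρ.part a).erase a, ?_, Finpartition.ext ?_⟩
  · rw [Finset.mem_insert, hmem]
    tauto
  · ext c
    rw [parts_adjoin, Finset.mem_insert, Finset.mem_erase, hmem, Finset.insert_erase hapart]
    constructor
    · rintro (rfl | ⟨h, -, h' | h'⟩)
      · exact hpart
      · exact h'.1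
      · exact absurd h' h
    · intro hc
      by_cases hac : a ∈ c
      · exact Or.inl (ρ.part_eq_of_mem hc hac).symm
      · refine Or.inr ⟨?_, ρ.ne_empty hc, Or.inl ⟨hc, hac⟩⟩
        rintro rfl
        obtain ⟨b, hb⟩ := ρ.nonempty_of_mem_parts hc
        rw [ρ.eq_of_mem_parts hc hpart hb (Finset.mem_of_mem_erase hb)] at hac
        exact hac hapart

theorem sum_insert {M : Type*} [AddCommMonoid M] {s : Finset ι} {a : ι} (ha : a ∉ s)
    (F : Finset (Finset ι) → M) :
    ∑ ρ : Finpartition (insert a s), F ρ.parts =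
      ∑ π : Finpartition s,
        (F (insert {a} π.parts) + ∑ B ∈ π.parts, F (insert (insert a B) (π.parts.erase B))) := by
  have h (π : Finpartition s) :
      F (insert {a} π.parts) + ∑ B ∈ π.parts, F (insert (insert a B) (π.parts.erase B)) =
        ∑ B ∈ insert ∅ π.parts, F (insert (insert a B) (π.parts.erase B)) := by
    rw [Finset.sum_insert π.empty_notMem_parts,
      Finset.erase_eq_of_notMem π.empty_notMem_parts, insert_empty_eq]
  simp_rw [h]
  rw [Finset.sum_sigma']
  symm
  refine Finset.sum_bij (fun p hp => p.1.adjoin ha p.2 (Finset.mem_sigma.1 hp).2)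
    (fun _ _ => Finset.mem_univ _) ?_ ?_ (fun _ _ => rfl)
  · rintro ⟨π, B⟩ _ ⟨π', B'⟩ _ h
    obtain ⟨rfl, rfl⟩ := adjoin_inj ha h
    rfl
  · intro ρ _
    obtain ⟨π, B, hB, h⟩ := exists_adjoin_eq ha ρ
    exact ⟨⟨π, B⟩, by simpa using hB, h⟩

end Finpartition

section FaaDiBruno

variable {E : Type*} [NormedAddCommGroup E] [NormedSpace ℝ E]

theorem hasLineDerivAt_iteratedDeriv_comp_mul_prod {κ : Type*} [DecidableEq κ] {f : ℝ → ℝ}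
    (hf : ContDiff ℝ ∞ f) {y : E → ℝ} (hy : ContDiff ℝ ∞ y) (k : ℕ) (P : Finset κ)
    {g : κ → E → ℝ} (hg : ∀ B, ContDiff ℝ ∞ (g B)) (x w : E) :
    HasLineDerivAt ℝ (fun z => iteratedDeriv k f (y z) * ∏ B ∈ P, g B z)
      (iteratedDeriv (k + 1) f (y x) * (lineDeriv ℝ y x w * ∏ B ∈ P, g B x) +
        ∑ B ∈ P, iteratedDeriv k f (y x) * (lineDeriv ℝ (g B) x w * ∏ C ∈ P.erase B, g C x))
      x w := by
  have hfk : HasDerivAt (iteratedDeriv k f) (iteratedDeriv (k + 1) f (y x)) (y x) := by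
    rw [iteratedDeriv_succ]
    exact (hf.differentiable_iteratedDeriv k (by exact_mod_cast ENat.natCast_lt_top k) _).hasDerivAt
  have hline {h : E → ℝ} (hh : ContDiff ℝ ∞ h) :
      HasDerivAt (fun t : ℝ => h (x + t • w)) (lineDeriv ℝ h x w) 0 :=
    (hh.differentiable (by simp) x).lineDifferentiableAt.hasLineDerivAt
  have h₁ : HasDerivAt (fun t : ℝ => iteratedDeriv k f (y (x + t • w)))
      (iteratedDeriv (k + 1) f (y x) * lineDeriv ℝ y x w) 0 :=
    HasDerivAt.comp (0 : ℝ) (h₂ := iteratedDeriv k f) (by simpa using hfk) (hline hy)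
  have h₂ := HasDerivAt.fun_finsetProd (u := P) fun B _ => hline (hg B)
  refine (h₁.mul h₂).congr_deriv ?_
  simp only [zero_smul, add_zero, smul_eq_mul, Finset.mul_sum]
  congr 1
  · ring
  · exact Finset.sum_congr rfl fun B _ => by ring

/-- Faà di Bruno's formula for directional derivatives indexed by a finite set. -/
theorem iterLineDeriv_toList_comp {ι : Type*} [DecidableEq ι] {f : ℝ → ℝ}
    (hf : ContDiff ℝ ∞ f) {y : E → ℝ} (hy : ContDiff ℝ ∞ y) (v : ι → E) (s : Finset ι) (x : E) :
    iterLineDeriv (s.toList.map v) (f ∘ y) x =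
      ∑ π : Finpartition s, iteratedDeriv π.parts.card f (y x) *
        ∏ B ∈ π.parts, iterLineDeriv (B.toList.map v) y x := by
  induction s using Finset.induction_on generalizing x with
  | empty =>
    have huniv (π : Finpartition (∅ : Finset ι)) : π.parts = ∅ := π.parts_eq_empty_iff.2 rfl
    have hcard : Fintype.card (Finpartition (∅ : Finset ι)) = 1 :=
      Fintype.card_eq_one_iff.2 ⟨Finpartition.empty _, fun π =>
        Finpartition.ext ((huniv π).trans (huniv _).symm)⟩
    simp [huniv, hcard, iterLineDeriv]
  | insert a s ha ih =>
    rw [iterLineDeriv_toList_insert (hf.comp hy) v ha, funext ih,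
      Finpartition.sum_insert ha fun P => iteratedDeriv P.card f (y x) *
        ∏ B ∈ P, iterLineDeriv (B.toList.map v) y x]
    have hD (π : Finpartition s) := hasLineDerivAt_iteratedDeriv_comp_mul_prod hf hy
      π.parts.card π.parts (fun B => hy.iterLineDeriv (B.toList.map v)) x (v a)
    have hsum : HasLineDerivAt ℝ (fun z => ∑ π : Finpartition s,
        iteratedDeriv π.parts.card f (y z) *
          ∏ B ∈ π.parts, iterLineDeriv (B.toList.map v) y z) _ x (v a) :=
      HasDerivAt.fun_sum fun π _ => hD π
    rw [hsum.lineDeriv]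
    refine Finset.sum_congr rfl fun π _ => ?_
    have hna {B : Finset ι} (hB : B ∈ π.parts) : a ∉ B := fun h => ha (π.le hB h)
    congr 1
    · have hnot : {a} ∉ π.parts := fun h => hna h (Finset.mem_singleton_self a)
      rw [Finset.card_insert_of_notMem hnot, Finset.prod_insert hnot, Finset.toList_singleton]
      rfl
    · refine Finset.sum_congr rfl fun B hB => ?_
      have hnot : insert a B ∉ π.parts.erase B := fun h =>
        hna (Finset.mem_of_mem_erase h) (Finset.mem_insert_self a B)
      rw [Finset.card_insert_of_notMem hnot, Finset.prod_insert hnot,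
        Finset.card_erase_add_one hB, iterLineDeriv_toList_insert hy v (hna hB)]

end FaaDiBruno

/-- Faà di Bruno's formula for iterated directional derivatives along arbitrary
(not necessarily distinct) vectors `v₁, …, vₙ`: the iterated directional derivative of
`f ∘ y` along `v₁, …, vₙ` is the sum over all partitions `π` of `{1, …, n}` of
`f^(|π|)(y x)` times the product over blocks `B` of `π` of the iterated directional
derivative of `y` along `(v_j)_{j ∈ B}`.  In particular, identifying some of the
differentiation variables with one another leaves the formula unchanged. -/
theorem iterLineDeriv_comp_eq_sum_finpartitions
    {E : Type*} [NormedAddCommGroup E] [NormedSpace ℝ E]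
    (n : ℕ) (hn : 0 < n)
    (f : ℝ → ℝ) (hf : ContDiff ℝ (⊤ : ℕ∞) f)
    (y : E → ℝ) (hy : ContDiff ℝ (⊤ : ℕ∞) y)
    (v : Fin n → E) (x : E) :
    iterLineDeriv ((List.finRange n).map v) (f ∘ y) x =
      ∑ π : Finpartition (Finset.univ : Finset (Fin n)),
        iteratedDeriv π.parts.card f (y x) *
          ∏ B ∈ π.parts, iterLineDeriv (B.toList.map v) y x := by
  have hperm : (List.finRange n).Perm (Finset.univ : Finset (Fin n)).toList :=
    (List.perm_ext_iff_of_nodup (List.nodup_finRange n) (Finset.nodup_toList _)).2 (by simp)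
  rw [iterLineDeriv_perm (hf.comp hy) (hperm.map v)]
  exact iterLineDeriv_toList_comp hf hy v Finset.univ x
end

section
/- Let n be a positive natural number, k₁, …, kₙ positive natural numbers with N = k₁ + ⋯ + kₙ, and let τ be the multiset over {1, …, n} containing each i with multiplicity kᵢ. Then the sum, over all partitions of the multiset τ (each written as m₁τ₁ + ⋯ + m_sτ_s with τ₁, …, τ_s pairwise distinct nonempty multisets and multiplicities mᵢ ≥ 1), of the quantity (k₁! ⋯ kₙ!) / (τ₁!!^{m₁} ⋯ τ_s!!^{m_s} · m₁! ⋯ m_s!) equals the Bell number B_N, the total number of partitions of a set of size N ('conservation of Bell numbers'). -/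
/-- `σ!!`: the product of the factorials of the multiplicities of the members of the
multiset `σ`.  For example `{1,1,1,1,2,2,2}!! = 4! * 3!`. -/
def multisetFactorial {α : Type*} [DecidableEq α] (σ : Multiset α) : ℕ :=
  ∏ a ∈ σ.toFinset, (σ.count a).factorial

open Finset

/-- The families of finsets that decompose `S` as a disjoint union, and whose members are mapped
by `f` to the members of the multiset `P`. -/
def partitionsWithImage {α β : Type*} [DecidableEq α] [DecidableEq β] (f : α → β) (S : Finset α)
    (P : Multiset (Multiset β)) : Finset (Finset (Finset α)) :=
  {Q ∈ S.powerset.powerset | ∑ T ∈ Q, T.val = S.val ∧ Q.val.map (fun T => T.val.map f) = P}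

theorem mem_partitionsWithImage {α β : Type*} [DecidableEq α] [DecidableEq β] {f : α → β}
    {S : Finset α} {P : Multiset (Multiset β)} {Q : Finset (Finset α)} :
    Q ∈ partitionsWithImage f S P ↔
      ∑ T ∈ Q, T.val = S.val ∧ Q.val.map (fun T => T.val.map f) = P := by
  simp only [partitionsWithImage, mem_filter, mem_powerset, and_iff_right_iff_imp]
  rintro ⟨h, -⟩ T hT
  rw [mem_powerset, ← val_le_iff, ← h]
  exact single_le_sum (f := fun T : Finset α => T.val) (fun _ _ => Multiset.zero_le _) hT

theorem multisetFactorial_eq_prod_univ {β : Type*} [DecidableEq β] [Fintype β] (σ : Multiset β) :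
    multisetFactorial σ = ∏ b, (σ.count b).factorial := by
  refine prod_subset (subset_univ _) fun b _ hb => ?_
  rw [Multiset.mem_toFinset] at hb
  simp [Multiset.count_eq_zero_of_notMem hb]

theorem multisetFactorial_cons {β : Type*} [DecidableEq β] (a : β) (σ : Multiset β) :
    multisetFactorial (a ::ₘ σ) = (a ::ₘ σ).count a * multisetFactorial σ := by
  have h : multisetFactorial σ = ∏ b ∈ (a ::ₘ σ).toFinset, (σ.count b).factorial := by
    refine prod_subset (fun b hb => by simp_all) fun b _ hb => ?_
    rw [Multiset.mem_toFinset] at hb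
    simp [Multiset.count_eq_zero_of_notMem hb]
  have ha : a ∈ (a ::ₘ σ).toFinset := by simp
  rw [h, multisetFactorial, ← mul_prod_erase _ _ ha, ← mul_prod_erase _ _ ha,
    Multiset.count_cons_self, Nat.factorial_succ, mul_assoc]
  congr 2
  refine prod_congr rfl fun b hb => ?_
  rw [Multiset.count_cons_of_ne (ne_of_mem_erase hb)]

theorem multisetFactorial_pos {β : Type*} [DecidableEq β] (σ : Multiset β) :
    0 < multisetFactorial σ :=
  prod_pos fun _ _ => Nat.factorial_pos _

theorem card_powerset_filter_map_eq {α β : Type*} [DecidableEq α] [DecidableEq β] [Fintype β]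
    (f : α → β) (S : Finset α) (σ : Multiset β) :
    #{T ∈ S.powerset | T.val.map f = σ} =
      ∏ b, ((S.val.map f).count b).choose (σ.count b) := by
  induction S using Finset.induction_on generalizing σ with
  | empty =>
    by_cases hσ : σ = 0
    · subst hσ
      simp [filter_singleton]
    · obtain ⟨b, hb⟩ := Multiset.exists_mem_of_ne_zero hσ
      rw [prod_eq_zero (mem_univ b)]
      · simp [filter_singleton, Ne.symm hσ]
      · rw [empty_val, Multiset.map_zero, Multiset.count_zero]
        exact Nat.choose_eq_zero_of_lt (Multiset.count_pos.2 hb)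
  | insert x S hx ih =>
    have hmap : (insert x S).val.map f = f x ::ₘ S.val.map f := by
      rw [insert_val_of_notMem hx, Multiset.map_cons]
    have hdisj : Disjoint (S.powerset) (S.powerset.image (insert x)) := by
      rw [disjoint_left]
      intro T hT hT'
      obtain ⟨U, -, rfl⟩ := mem_image.1 hT'
      exact hx (mem_powerset.1 hT (mem_insert_self x U))
    have hinj : Set.InjOn (insert x) (S.powerset : Set (Finset α)) := by
      intro T hT U hU h
      rw [mem_coe, mem_powerset] at hT hU
      rw [← erase_insert (fun h => hx (hT h)), h, erase_insert (fun h => hx (hU h))]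
    have hval : ∀ T ∈ S.powerset, (insert x T).val.map f = f x ::ₘ T.val.map f := by
      intro T hT
      rw [insert_val_of_notMem (fun h => hx (mem_powerset.1 hT h)), Multiset.map_cons]
    rw [powerset_insert, filter_union, card_union_of_disjoint
      (disjoint_filter_filter hdisj), ih, filter_image,
      card_image_of_injOn (hinj.mono (filter_subset _ _)),
      filter_congr (q := fun T => f x ::ₘ T.val.map f = σ) (fun T hT => by rw [hval T hT]), hmap,
      ← mul_prod_erase _ _ (mem_univ (f x)), ← mul_prod_erase _ _ (mem_univ (f x))]
    have hrest : ∏ b ∈ univ.erase (f x), ((f x ::ₘ S.val.map f).count b).choose (σ.count b) =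
        ∏ b ∈ univ.erase (f x), ((S.val.map f).count b).choose (σ.count b) :=
      prod_congr rfl fun b hb => by rw [Multiset.count_cons_of_ne (ne_of_mem_erase hb)]
    rw [hrest, Multiset.count_cons_self]
    by_cases ha : f x ∈ σ
    · obtain ⟨ρ, rfl⟩ := Multiset.exists_cons_of_mem ha
      simp only [Multiset.cons_inj_right]
      rw [ih, ← mul_prod_erase _ _ (mem_univ (f x)), Multiset.count_cons_self,
        Nat.choose_succ_succ, add_mul, add_comm]
      congr 2
      refine prod_congr rfl fun b hb => ?_
      rw [Multiset.count_cons_of_ne (ne_of_mem_erase hb)]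
    · rw [filter_false_of_mem (fun T _ h =>
        ha (by rw [← h]; exact Multiset.mem_cons_self _ _)),
        Multiset.count_eq_zero_of_notMem ha]
      simp

theorem card_powerset_filter_map_mul {α β : Type*} [DecidableEq α] [DecidableEq β] [Fintype β]
    {f : α → β} {S : Finset α} {σ ρ : Multiset β} (h : S.val.map f = σ + ρ) :
    #{T ∈ S.powerset | T.val.map f = σ} * multisetFactorial σ * multisetFactorial ρ =
      multisetFactorial (σ + ρ) := by
  simp only [card_powerset_filter_map_eq, h, multisetFactorial_eq_prod_univ, ← prod_mul_distrib,
    Multiset.count_add]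
  exact prod_congr rfl fun b _ => by
    simpa using Nat.choose_mul_factorial_mul_factorial
      (Nat.le_add_right (σ.count b) (ρ.count b))

theorem notMem_of_sum_val_eq_sdiff {α β : Type*} [DecidableEq α] {f : α → β} {S T : Finset α}
    {Q : Finset (Finset α)} {σ : Multiset β} (hσ : σ ≠ 0) (hT : T.val.map f = σ)
    (hQ : ∑ U ∈ Q, U.val = (S \ T).val) : T ∉ Q := by
  intro h
  have hle : T ≤ S \ T := by
    rw [← val_le_iff, ← hQ]
    exact single_le_sum (f := fun U : Finset α => U.val) (fun _ _ => Multiset.zero_le _) h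
  obtain rfl : T = ∅ := by
    simpa using disjoint_sdiff.eq_bot_of_le hle
  exact hσ (by simpa using hT.symm)

/-- Double counting of the families with a distinguished member whose image is `σ`. -/
theorem card_partitionsWithImage_cons {α β : Type*} [DecidableEq α] [DecidableEq β]
    (f : α → β) (S : Finset α) {σ : Multiset β} (hσ : σ ≠ 0) (P : Multiset (Multiset β)) :
    #(partitionsWithImage f S (σ ::ₘ P)) * (σ ::ₘ P).count σ =
      ∑ T ∈ S.powerset with T.val.map f = σ, #(partitionsWithImage f (S \ T) P) := by
  have hcount : ∀ Q ∈ partitionsWithImage f S (σ ::ₘ P),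
      #{T ∈ Q | T.val.map f = σ} = (σ ::ₘ P).count σ := by
    intro Q hQ
    rw [← (mem_partitionsWithImage.1 hQ).2, Multiset.count_map]
    simp only [eq_comm (a := σ)]
    rfl
  rw [← smul_eq_mul, ← sum_const, ← sum_congr rfl hcount, ← card_sigma, ← card_sigma]
  refine card_bij' (fun p _ => ⟨p.2, p.1.erase p.2⟩) (fun p _ => ⟨insert p.1 p.2, p.1⟩)
    ?_ ?_ ?_ ?_
  · rintro ⟨Q, T⟩ h
    simp only [mem_sigma, mem_filter, mem_partitionsWithImage, mem_powerset] at h ⊢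
    obtain ⟨⟨h1, h2⟩, hT, h3⟩ := h
    rw [← add_sum_erase _ _ hT] at h1
    have hTS : T ⊆ S := by
      rw [← val_le_iff, ← h1]
      exact Multiset.le_add_right _ _
    refine ⟨⟨hTS, h3⟩, ?_, ?_⟩
    · rw [sdiff_val, ← h1, add_tsub_cancel_left]
    · rw [← insert_erase hT, insert_val_of_notMem (notMem_erase _ _), Multiset.map_cons, h3,
        Multiset.cons_inj_right] at h2
      exact h2
  · rintro ⟨T, Q⟩ h
    simp only [mem_sigma, mem_filter, mem_partitionsWithImage, mem_powerset] at h ⊢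
    obtain ⟨⟨hTS, h3⟩, h1, h2⟩ := h
    have hT := notMem_of_sum_val_eq_sdiff hσ h3 h1
    refine ⟨⟨?_, ?_⟩, mem_insert_self _ _, h3⟩
    · rw [sum_insert hT, h1, sdiff_val, add_tsub_cancel_of_le (val_le_iff.2 hTS)]
    · rw [insert_val_of_notMem hT, Multiset.map_cons, h2, h3]
  · rintro ⟨Q, T⟩ h
    simp only [mem_sigma, mem_filter] at h
    simp [insert_erase h.2.1]
  · rintro ⟨T, Q⟩ h
    simp only [mem_sigma, mem_filter, mem_partitionsWithImage] at h
    simp [erase_insert (notMem_of_sum_val_eq_sdiff hσ h.1.2 h.2.1)]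

theorem card_partitionsWithImage_mul {α β : Type*} [DecidableEq α] [DecidableEq β] [Fintype β]
    (f : α → β) {S : Finset α} {P : Multiset (Multiset β)} (hS : S.val.map f = P.sum)
    (hP : 0 ∉ P) :
    #(partitionsWithImage f S P) * ((P.map multisetFactorial).prod * multisetFactorial P) =
      multisetFactorial P.sum := by
  induction P using Multiset.induction_on generalizing S with
  | empty =>
    obtain rfl : S = ∅ := by simpa using hS
    have : partitionsWithImage f ∅ 0 = {∅} := by
      ext Q
      rw [mem_partitionsWithImage, mem_singleton]
      constructor
      · rintro ⟨-, h⟩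
        simpa using h
      · rintro rfl
        simp
    simp [this, multisetFactorial]
  | cons σ P ih =>
    rw [Multiset.mem_cons, not_or] at hP
    rw [Multiset.sum_cons] at hS ⊢
    rw [Multiset.map_cons, Multiset.prod_cons, multisetFactorial_cons]
    calc _ = (#(partitionsWithImage f S (σ ::ₘ P)) * (σ ::ₘ P).count σ) *
          (multisetFactorial σ * ((P.map multisetFactorial).prod * multisetFactorial P)) := by ring
      _ = ∑ T ∈ S.powerset with T.val.map f = σ,
          multisetFactorial σ * multisetFactorial P.sum := by
        rw [card_partitionsWithImage_cons f S (Ne.symm hP.1), sum_mul]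
        refine sum_congr rfl fun T hT => ?_
        rw [mem_filter, mem_powerset] at hT
        have hT' : (S \ T).val.map f = P.sum := by
          have := congrArg (Multiset.map f) (add_tsub_cancel_of_le (val_le_iff.2 hT.1))
          rw [Multiset.map_add, hS, hT.2, add_right_inj] at this
          rw [sdiff_val, this]
        rw [← ih hT' hP.2]
        ring
      _ = multisetFactorial (σ + P.sum) := by
        rw [sum_const, smul_eq_mul, ← mul_assoc, card_powerset_filter_map_mul hS]

theorem Finpartition.sum_parts_val {α : Type*} [DecidableEq α] {S : Finset α}
    (π : Finpartition S) : ∑ T ∈ π.parts, T.val = S.val := by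
  exact congrArg Finset.val
    ((disjiUnion_eq_biUnion π.parts id π.disjoint).trans π.biUnion_parts)

theorem pairwiseDisjoint_of_sum_val_eq {α : Type*} [DecidableEq α] {S : Finset α}
    {Q : Finset (Finset α)} (h : ∑ T ∈ Q, T.val = S.val) :
    (Q : Set (Finset α)).PairwiseDisjoint id := by
  intro T hT U hU hne
  refine disjoint_left.2 fun x hxT hxU => ?_
  have hle : T.val + U.val ≤ S.val := by
    rw [← h, ← sum_pair (f := fun T : Finset α => T.val) hne]
    exact sum_le_sum_of_subset (by simp_all [insert_subset_iff])
  have hc := (Multiset.count_le_of_le x hle).trans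
    (Multiset.nodup_iff_count_le_one.1 S.nodup x)
  have h1 := Multiset.count_pos.2 (show x ∈ T.val from hxT)
  have h2 := Multiset.count_pos.2 (show x ∈ U.val from hxU)
  rw [Multiset.count_add] at hc
  omega

theorem card_finpartition_filter_map_eq {α β : Type*} [DecidableEq α] [DecidableEq β]
    (f : α → β) (S : Finset α) {P : Multiset (Multiset β)} (hP : 0 ∉ P) :
    #{π : Finpartition S | π.parts.val.map (fun T => T.val.map f) = P} =
      #(partitionsWithImage f S P) := by
  refine card_bij (fun π _ => π.parts) ?_ ?_ ?_
  · intro π hπ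
    exact mem_partitionsWithImage.2 ⟨π.sum_parts_val, (mem_filter.1 hπ).2⟩
  · intro π _ π' _ h
    exact Finpartition.ext h
  · intro Q hQ
    obtain ⟨h1, h2⟩ := mem_partitionsWithImage.1 hQ
    have hdisj := pairwiseDisjoint_of_sum_val_eq h1
    refine ⟨⟨Q, supIndep_iff_pairwiseDisjoint.2 hdisj, ?_, ?_⟩, by simpa using h2, rfl⟩
    · rw [sup_eq_biUnion, ← disjiUnion_eq_biUnion Q id hdisj, ← val_inj, ← h1]
      rfl
    · intro h
      refine hP ?_
      rw [← h2]
      exact Multiset.mem_map.2 ⟨∅, h, rfl⟩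

/-- Conservation of Bell numbers: the sum, over all partitions
`P = m₁τ₁ + ⋯ + m_sτ_s` of the multiset `τ` (containing each `i` with multiplicity
`kᵢ`) into nonempty multisets, of `(k₁! ⋯ kₙ!) / (τ₁!!^{m₁} ⋯ τ_s!!^{m_s} · m₁! ⋯ m_s!)`
is the Bell number `B_N`, the number of partitions of a set of size `N = k₁ + ⋯ + kₙ`.
Here `∏ᵢ τᵢ!!^{mᵢ}` is the product of `σ!!` over the members `σ` of `P` counted with
multiplicity, and `∏ᵢ mᵢ!` is the product of the factorials of the multiplicities of
the members of `P`, i.e. `P!!`. -/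
theorem sum_multiset_partition_multiplicities_eq_bell (n : ℕ) (hn : 0 < n)
    (k : Fin n → ℕ) (hk : ∀ i, 0 < k i) (N : ℕ) (hN : N = ∑ i, k i)
    (τ : Multiset (Fin n)) (hτ : τ = ∑ i, Multiset.replicate (k i) i) :
    ∑ᶠ (P : Multiset (Multiset (Fin n)))
      (_ : P.sum = τ ∧ (0 : Multiset (Fin n)) ∉ P),
        (∏ i, (k i).factorial) /
          ((P.map multisetFactorial).prod * multisetFactorial P) =
      Fintype.card (Finpartition (Finset.univ : Finset (Fin N))) := by
  subst hN
  have hcard : τ.toList.length = ∑ i, k i := by simp [hτ]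
  obtain ⟨f, hf⟩ : ∃ f : Fin (∑ i, k i) → Fin n, univ.val.map f = τ := by
    rw [← hcard]
    exact ⟨τ.toList.get, by rw [Fin.univ_val_map, List.ofFn_get, Multiset.coe_toList]⟩
  have hfact : multisetFactorial τ = ∏ i, (k i).factorial := by
    rw [multisetFactorial_eq_prod_univ]
    refine prod_congr rfl fun i _ => ?_
    simp [hτ, Multiset.count_sum', Multiset.count_replicate]
  let img : Finpartition (univ : Finset (Fin (∑ i, k i))) → Multiset (Multiset (Fin n)) :=
    fun π => π.parts.val.map fun T => T.val.map f
  have hmul : ∀ P : Multiset (Multiset (Fin n)), P.sum = τ ∧ 0 ∉ P →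
      #{π | img π = P} * ((P.map multisetFactorial).prod * multisetFactorial P) =
        ∏ i, (k i).factorial := by
    rintro P ⟨hP, h0⟩
    rw [card_finpartition_filter_map_eq f univ h0,
      card_partitionsWithImage_mul f (hf.trans hP.symm) h0, hP, hfact]
  have himg : {P : Multiset (Multiset (Fin n)) | P.sum = τ ∧ 0 ∉ P} =
      (univ.image img : Finset (Multiset (Multiset (Fin n)))) := by
    ext P
    simp only [Set.mem_ofPred_eq, coe_image, coe_univ, Set.image_univ, Set.mem_range]
    constructor
    · intro hP
      have hpos : 0 < #{π | img π = P} := by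
        refine Nat.pos_of_mul_pos_right (b := (P.map multisetFactorial).prod * multisetFactorial P) ?_
        rw [hmul P hP]
        exact prod_pos fun _ _ => Nat.factorial_pos _
      obtain ⟨π, hπ⟩ := card_pos.1 hpos
      exact ⟨π, (mem_filter.1 hπ).2⟩
    · rintro ⟨π, rfl⟩
      constructor
      · rw [← hf, ← π.sum_parts_val]
        exact (map_sum (Multiset.mapAddMonoidHom f) _ _).symm
      · intro h
        obtain ⟨T, hT, h⟩ := Multiset.mem_map.1 h
        obtain rfl : T = ∅ := by simpa using h
        exact π.bot_notMem hT
  change ∑ᶠ (P) (_ : P ∈ {P : Multiset (Multiset (Fin n)) | P.sum = τ ∧ 0 ∉ P}), _ = _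
  rw [himg, finsum_mem_coe_finset, ← card_univ, card_eq_sum_card_image img univ]
  refine sum_congr rfl fun P hP => ?_
  have hP' : P.sum = τ ∧ 0 ∉ P := by
    rwa [← mem_coe, ← himg] at hP
  rw [← hmul P hP']
  refine Nat.mul_div_cancel _ (Nat.mul_pos ?_ (multisetFactorial_pos P))
  refine Nat.pos_of_ne_zero (Multiset.prod_ne_zero fun h => ?_)
  obtain ⟨σ, -, h⟩ := Multiset.mem_map.1 h
  exact (multisetFactorial_pos σ).ne' h
end
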